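/- arXiv:2212.13045 — 2 statements merged into one kernel-verified Lean document; each statement's English description precedes it below -/
import Mathlib

section
/- Let T be a continuous Archimedean t-norm on [0,1] and u ∈ [0,1]. Then the function t ↦ u_T^(t) is continuous on (0,∞), and lim_{t→+∞} u_T^(t) = 0 if u ∈ [0,1) and lim_{t→+∞} u_T^(t) = 1 if u = 1. -/
open Set

/-- A t-norm on `[0,1]`: commutative, associative, nondecreasing in each argument,
with neutral element `1`. -/
structure IsTnorm (T : ℝ → ℝ → ℝ) : Prop where
  maps_to : ∀ x ∈ Icc (0:ℝ) 1, ∀ y ∈ Icc (0:ℝ) 1, T x y ∈ Icc (0:ℝ) 1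
  comm : ∀ x ∈ Icc (0:ℝ) 1, ∀ y ∈ Icc (0:ℝ) 1, T x y = T y x
  assoc : ∀ x ∈ Icc (0:ℝ) 1, ∀ y ∈ Icc (0:ℝ) 1, ∀ z ∈ Icc (0:ℝ) 1,
    T (T x y) z = T x (T y z)
  mono : ∀ x ∈ Icc (0:ℝ) 1, ∀ y ∈ Icc (0:ℝ) 1, ∀ z ∈ Icc (0:ℝ) 1,
    y ≤ z → T x y ≤ T x z
  one : ∀ x ∈ Icc (0:ℝ) 1, T x 1 = x

/-- A t-conorm on `[0,1]`: commutative, associative, nondecreasing in each argument,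
with neutral element `0`. -/
structure IsTconorm (S : ℝ → ℝ → ℝ) : Prop where
  maps_to : ∀ x ∈ Icc (0:ℝ) 1, ∀ y ∈ Icc (0:ℝ) 1, S x y ∈ Icc (0:ℝ) 1
  comm : ∀ x ∈ Icc (0:ℝ) 1, ∀ y ∈ Icc (0:ℝ) 1, S x y = S y x
  assoc : ∀ x ∈ Icc (0:ℝ) 1, ∀ y ∈ Icc (0:ℝ) 1, ∀ z ∈ Icc (0:ℝ) 1,
    S (S x y) z = S x (S y z)
  mono : ∀ x ∈ Icc (0:ℝ) 1, ∀ y ∈ Icc (0:ℝ) 1, ∀ z ∈ Icc (0:ℝ) 1,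
    y ≤ z → S x y ≤ S x z
  zero : ∀ x ∈ Icc (0:ℝ) 1, S x 0 = x

/-- Continuity of a binary operation on the unit square. -/
def ContinuousOn2 (T : ℝ → ℝ → ℝ) : Prop :=
  ContinuousOn (fun p : ℝ × ℝ => T p.1 p.2) (Icc (0:ℝ) 1 ×ˢ Icc (0:ℝ) 1)

/-- `n`-fold power `u_T^(n)` with respect to a t-norm: `u_T^(0) = 1`,
`u_T^(n+1) = T (u_T^(n)) u`. -/
def Tpow (T : ℝ → ℝ → ℝ) (u : ℝ) : ℕ → ℝ
  | 0 => 1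
  | n + 1 => T (Tpow T u n) u

/-- `n`-fold power `u_S^(n)` with respect to a t-conorm: `u_S^(0) = 0`,
`u_S^(n+1) = S (u_S^(n)) u`. -/
def Spow (S : ℝ → ℝ → ℝ) (u : ℝ) : ℕ → ℝ
  | 0 => 0
  | n + 1 => S (Spow S u n) u

/-- `p`-th root `u_T^(1/p) = sup {v ∈ [0,1] | v_T^(p) < u}`. -/
noncomputable def Troot (T : ℝ → ℝ → ℝ) (u : ℝ) (p : ℕ) : ℝ :=
  sSup {v ∈ Icc (0:ℝ) 1 | Tpow T v p < u}

/-- `p`-th root `u_S^(1/p) = inf {v ∈ [0,1] | v_S^(p) > u}`. -/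
noncomputable def Sroot (S : ℝ → ℝ → ℝ) (u : ℝ) (p : ℕ) : ℝ :=
  sInf {v ∈ Icc (0:ℝ) 1 | u < Spow S v p}

/-- Rational power `u_T^(q/p) = (u_T^(1/p))_T^(q)`, with `r = q/p` in lowest terms. -/
noncomputable def TratPow (T : ℝ → ℝ → ℝ) (u : ℝ) (r : ℚ) : ℝ :=
  Tpow T (Troot T u r.den) r.num.toNat

/-- Rational power `u_S^(q/p) = (u_S^(1/p))_S^(q)`, with `r = q/p` in lowest terms. -/
noncomputable def SratPow (S : ℝ → ℝ → ℝ) (u : ℝ) (r : ℚ) : ℝ :=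
  Spow S (Sroot S u r.den) r.num.toNat

/-- Real power `u_T^(t) = inf {u_T^(r) | r ∈ [0,t] ∩ ℚ}`. -/
noncomputable def TrePow (T : ℝ → ℝ → ℝ) (u : ℝ) (t : ℝ) : ℝ :=
  sInf (TratPow T u '' {r : ℚ | 0 ≤ r ∧ (r : ℝ) ≤ t})

/-- Real power `u_S^(t) = sup {u_S^(r) | r ∈ [0,t] ∩ ℚ}`. -/
noncomputable def SrePow (S : ℝ → ℝ → ℝ) (u : ℝ) (t : ℝ) : ℝ :=
  sSup (SratPow S u '' {r : ℚ | 0 ≤ r ∧ (r : ℝ) ≤ t})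

/-- A t-norm is Archimedean if for all `x, y ∈ (0,1)` there is `n` with `x_T^(n) < y`. -/
def TnormArchimedean (T : ℝ → ℝ → ℝ) : Prop :=
  ∀ x ∈ Ioo (0:ℝ) 1, ∀ y ∈ Ioo (0:ℝ) 1, ∃ n : ℕ, Tpow T x n < y

/-- Strict monotonicity of a t-norm: `T x y < T x z` whenever `x > 0` and `y < z`. -/
def TnormStrictMono (T : ℝ → ℝ → ℝ) : Prop :=
  ∀ x ∈ Icc (0:ℝ) 1, 0 < x → ∀ y ∈ Icc (0:ℝ) 1, ∀ z ∈ Icc (0:ℝ) 1, y < z → T x y < T x z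

/-- Pseudo-inverse of a decreasing `G : [0,1] → [0,∞]`:
`G^(−1)(y) = sup {x ∈ [0,1] | G x > y}`. -/
noncomputable def pseudoInv (G : ℝ → ENNReal) (y : ENNReal) : ℝ :=
  sSup {x ∈ Icc (0:ℝ) 1 | y < G x}

/-- `G : [0,1] → [0,∞]` is an additive generator of the t-norm `T`. -/
structure IsAddGen (T : ℝ → ℝ → ℝ) (G : ℝ → ENNReal) : Prop where
  strictAnti : StrictAntiOn G (Icc (0:ℝ) 1)
  rightContinuousAtZero : ContinuousWithinAt G (Icc (0:ℝ) 1) 0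
  map_one : G 1 = 0
  sum_mem : ∀ x ∈ Icc (0:ℝ) 1, ∀ y ∈ Icc (0:ℝ) 1,
    G x + G y ∈ G '' Icc (0:ℝ) 1 ∪ Icc (G 0) ⊤
  eq_pseudoInv : ∀ x ∈ Icc (0:ℝ) 1, ∀ y ∈ Icc (0:ℝ) 1, T x y = pseudoInv G (G x + G y)

open Filter Topology

namespace IsTnorm

variable {T : ℝ → ℝ → ℝ}

theorem one_left (hT : IsTnorm T) {x : ℝ} (hx : x ∈ Icc (0:ℝ) 1) : T 1 x = x := by
  rw [hT.comm 1 (by simp) x hx, hT.one x hx]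

theorem le_left (hT : IsTnorm T) {x y : ℝ} (hx : x ∈ Icc (0:ℝ) 1) (hy : y ∈ Icc (0:ℝ) 1) :
    T x y ≤ x :=
  (hT.mono x hx y hy 1 (by simp) hy.2).trans_eq (hT.one x hx)

theorem le_right (hT : IsTnorm T) {x y : ℝ} (hx : x ∈ Icc (0:ℝ) 1) (hy : y ∈ Icc (0:ℝ) 1) :
    T x y ≤ y :=
  (hT.comm x hx y hy).trans_le (hT.le_left hy hx)

theorem zero_right (hT : IsTnorm T) {x : ℝ} (hx : x ∈ Icc (0:ℝ) 1) : T x 0 = 0 :=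
  le_antisymm (hT.le_right hx (by simp)) (hT.maps_to x hx 0 (by simp)).1

theorem mono_both (hT : IsTnorm T) {x x' y y' : ℝ} (hx : x ∈ Icc (0:ℝ) 1)
    (hx' : x' ∈ Icc (0:ℝ) 1) (hy : y ∈ Icc (0:ℝ) 1) (hy' : y' ∈ Icc (0:ℝ) 1)
    (hxx : x ≤ x') (hyy : y ≤ y') : T x y ≤ T x' y' := by
  refine (hT.mono x hx y hy y' hy' hyy).trans ?_
  rw [hT.comm x hx y' hy', hT.comm x' hx' y' hy']
  exact hT.mono y' hy' x hx x' hx' hxx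

theorem mul_mul_mul_comm (hT : IsTnorm T) {a b c d : ℝ} (ha : a ∈ Icc (0:ℝ) 1)
    (hb : b ∈ Icc (0:ℝ) 1) (hc : c ∈ Icc (0:ℝ) 1) (hd : d ∈ Icc (0:ℝ) 1) :
    T (T a b) (T c d) = T (T a c) (T b d) := by
  rw [hT.assoc a ha b hb _ (hT.maps_to c hc d hd), hT.assoc a ha c hc _ (hT.maps_to b hb d hd),
    ← hT.assoc b hb c hc d hd, ← hT.assoc c hc b hb d hd, hT.comm b hb c hc]

theorem pow_mem (hT : IsTnorm T) {v : ℝ} (hv : v ∈ Icc (0:ℝ) 1) (n : ℕ) :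
    Tpow T v n ∈ Icc (0:ℝ) 1 := by
  induction n with
  | zero => simp [Tpow]
  | succ n ih => exact hT.maps_to _ ih _ hv

theorem pow_one (hT : IsTnorm T) {v : ℝ} (hv : v ∈ Icc (0:ℝ) 1) : Tpow T v 1 = v :=
  hT.one_left hv

theorem one_pow (hT : IsTnorm T) (n : ℕ) : Tpow T 1 n = 1 := by
  induction n with
  | zero => rfl
  | succ n ih => simp only [Tpow, ih, hT.one 1 (by simp)]

theorem zero_pow (hT : IsTnorm T) {n : ℕ} (hn : 0 < n) : Tpow T 0 n = 0 := by
  obtain ⟨m, rfl⟩ := Nat.exists_eq_add_of_lt hn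
  exact hT.zero_right (hT.pow_mem (by simp) _)

theorem pow_add (hT : IsTnorm T) {v : ℝ} (hv : v ∈ Icc (0:ℝ) 1) (m n : ℕ) :
    Tpow T v (m + n) = T (Tpow T v m) (Tpow T v n) := by
  induction n with
  | zero => simp only [add_zero, Tpow, hT.one _ (hT.pow_mem hv m)]
  | succ n ih =>
    rw [← add_assoc, Tpow, ih, Tpow, hT.assoc _ (hT.pow_mem hv m) _ (hT.pow_mem hv n) _ hv]

theorem pow_mul (hT : IsTnorm T) {v : ℝ} (hv : v ∈ Icc (0:ℝ) 1) (m n : ℕ) :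
    Tpow T v (m * n) = Tpow T (Tpow T v m) n := by
  induction n with
  | zero => rfl
  | succ n ih => rw [Nat.mul_succ, hT.pow_add hv, ih, Tpow]

theorem mul_pow (hT : IsTnorm T) {v w : ℝ} (hv : v ∈ Icc (0:ℝ) 1) (hw : w ∈ Icc (0:ℝ) 1)
    (n : ℕ) : Tpow T (T v w) n = T (Tpow T v n) (Tpow T w n) := by
  induction n with
  | zero => simp only [Tpow, hT.one 1 (by simp)]
  | succ n ih =>
    rw [Tpow, ih, hT.mul_mul_mul_comm (hT.pow_mem hv n) (hT.pow_mem hw n) hv hw, Tpow, Tpow]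

theorem pow_le_pow_left (hT : IsTnorm T) {v w : ℝ} (hv : v ∈ Icc (0:ℝ) 1)
    (hw : w ∈ Icc (0:ℝ) 1) (h : v ≤ w) (n : ℕ) : Tpow T v n ≤ Tpow T w n := by
  induction n with
  | zero => rfl
  | succ n ih => exact hT.mono_both (hT.pow_mem hv n) (hT.pow_mem hw n) hv hw ih h

theorem pow_antitone (hT : IsTnorm T) {v : ℝ} (hv : v ∈ Icc (0:ℝ) 1) : Antitone (Tpow T v) :=
  antitone_nat_of_succ_le fun n => hT.le_left (hT.pow_mem hv n) hv

theorem continuousOn_pow (hT : IsTnorm T) (hTc : ContinuousOn2 T) (n : ℕ) :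
    ContinuousOn (fun v => Tpow T v n) (Icc (0:ℝ) 1) := by
  induction n with
  | zero => exact continuousOn_const
  | succ n ih =>
    exact ContinuousOn.comp (g := fun p : ℝ × ℝ => T p.1 p.2) hTc (ih.prodMk continuousOn_id)
      fun v hv => ⟨hT.pow_mem hv n, hv⟩

theorem exists_mul_eq (hT : IsTnorm T) (hTc : ContinuousOn2 T) {a b : ℝ}
    (ha : a ∈ Icc (0:ℝ) 1) (hb : b ∈ Icc (0:ℝ) 1) (hab : a ≤ b) :
    ∃ c ∈ Icc (0:ℝ) 1, T b c = a := by
  have hc : ContinuousOn (fun c => T b c) (Icc (0:ℝ) 1) :=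
    ContinuousOn.comp (g := fun p : ℝ × ℝ => T p.1 p.2) hTc
      (continuousOn_const.prodMk continuousOn_id) fun c hc => ⟨hb, hc⟩
  refine intermediate_value_Icc zero_le_one hc ?_
  simp only [hT.zero_right hb, hT.one b hb]
  exact ⟨ha.1, hab⟩

theorem exists_pow_lt (hT : IsTnorm T) (hA : TnormArchimedean T) {v y : ℝ}
    (hv : v ∈ Icc (0:ℝ) 1) (hv1 : v < 1) (hy : 0 < y) : ∃ n : ℕ, Tpow T v n < y := by
  rcases hv.1.eq_or_lt with rfl | hv0
  · exact ⟨1, by rwa [hT.pow_one hv]⟩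
  · obtain ⟨n, hn⟩ := hA v ⟨hv0, hv1⟩ (min y (1 / 2))
      ⟨by positivity, (min_le_right _ _).trans_lt (by norm_num)⟩
    exact ⟨n, hn.trans_le (min_le_left _ _)⟩

/-- Powers of elements below `1` tend to `0`. -/
theorem tendsto_pow_zero (hT : IsTnorm T) (hA : TnormArchimedean T) {v : ℝ}
    (hv : v ∈ Icc (0:ℝ) 1) (hv1 : v < 1) : Tendsto (Tpow T v) atTop (𝓝 0) := by
  rw [Metric.tendsto_atTop]
  intro ε hε
  obtain ⟨n, hn⟩ := hT.exists_pow_lt hA hv hv1 hε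
  refine ⟨n, fun m hm => ?_⟩
  rw [Real.dist_eq, sub_zero, abs_of_nonneg (hT.pow_mem hv m).1]
  exact (hT.pow_antitone hv hm).trans_lt hn

/-- A nonzero element is not absorbed by an element below `1`. -/
theorem mul_ne_left (hT : IsTnorm T) (hA : TnormArchimedean T) {x c : ℝ}
    (hx : x ∈ Icc (0:ℝ) 1) (hx0 : 0 < x) (hc : c ∈ Icc (0:ℝ) 1) (hc1 : c < 1) : T x c ≠ x := by
  intro h
  have key : ∀ n, T x (Tpow T c n) = x := by
    intro n
    induction n with
    | zero => exact hT.one x hx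
    | succ n ih => rw [Tpow, ← hT.assoc x hx _ (hT.pow_mem hc n) c hc, ih, h]
  obtain ⟨n, hn⟩ := hT.exists_pow_lt hA hc hc1 hx0
  exact (hT.le_right hx (hT.pow_mem hc n)).not_gt ((key n).symm ▸ hn)

theorem pow_lt_pow_left (hT : IsTnorm T) (hTc : ContinuousOn2 T) (hA : TnormArchimedean T)
    {v w : ℝ} (hv : v ∈ Icc (0:ℝ) 1) (hw : w ∈ Icc (0:ℝ) 1) (h : v < w) {n : ℕ} (hn : 0 < n)
    (hpos : 0 < Tpow T w n) : Tpow T v n < Tpow T w n := by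
  refine (hT.pow_le_pow_left hv hw h.le n).lt_of_ne ?_
  obtain ⟨c, hc, rfl⟩ := hT.exists_mul_eq hTc hv hw h.le
  have hc1 : c < 1 := hc.2.lt_of_ne (by rintro rfl; exact h.ne (hT.one w hw))
  have hcn : Tpow T c n < 1 := by
    refine (hT.pow_antitone hc hn).trans_lt ?_
    rwa [hT.pow_one hc]
  rw [hT.mul_pow hw hc]
  exact hT.mul_ne_left hA (hT.pow_mem hw n) hpos (hT.pow_mem hc n) hcn

/-- The root is the unique solution of the corresponding power equation. -/
theorem root_eq (hT : IsTnorm T) (hTc : ContinuousOn2 T) (hA : TnormArchimedean T)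
    {v : ℝ} (hv : v ∈ Icc (0:ℝ) 1) {n : ℕ} (hn : 0 < n) (hpos : 0 < Tpow T v n) :
    Troot T (Tpow T v n) n = v := by
  have hv0 : 0 < v := hpos.trans_le ((hT.pow_antitone hv hn).trans_eq (hT.pow_one hv))
  have hset : {w ∈ Icc (0:ℝ) 1 | Tpow T w n < Tpow T v n} = Ico 0 v := by
    ext w
    constructor
    · rintro ⟨hw, hlt⟩
      refine ⟨hw.1, lt_of_not_ge fun hle => ?_⟩
      exact hlt.not_ge (hT.pow_le_pow_left hv hw hle n)
    · rintro ⟨hw0, hwv⟩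
      have hw : w ∈ Icc (0:ℝ) 1 := ⟨hw0, hwv.le.trans hv.2⟩
      exact ⟨hw, hT.pow_lt_pow_left hTc hA hw hv hwv hn hpos⟩
  rw [Troot, hset, csSup_Ico hv0]

theorem exists_pow_eq (hT : IsTnorm T) (hTc : ContinuousOn2 T) {u : ℝ}
    (hu : u ∈ Icc (0:ℝ) 1) {n : ℕ} (hn : 0 < n) : ∃ v ∈ Icc (0:ℝ) 1, Tpow T v n = u := by
  refine intermediate_value_Icc zero_le_one (hT.continuousOn_pow hTc n) ?_
  simpa only [hT.zero_pow hn, hT.one_pow] using hu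

theorem root_mem (T : ℝ → ℝ → ℝ) (u : ℝ) (n : ℕ) : Troot T u n ∈ Icc (0:ℝ) 1 :=
  ⟨Real.sSup_nonneg fun _ h => h.1.1, Real.sSup_le (fun _ h => h.1.2) zero_le_one⟩

theorem root_pow (hT : IsTnorm T) (hTc : ContinuousOn2 T) (hA : TnormArchimedean T)
    {u : ℝ} (hu : u ∈ Icc (0:ℝ) 1) (hu0 : 0 < u) {n : ℕ} (hn : 0 < n) :
    Tpow T (Troot T u n) n = u := by
  obtain ⟨v, hv, rfl⟩ := hT.exists_pow_eq hTc hu hn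
  rw [hT.root_eq hTc hA hv hn hu0]

theorem root_mul_pow (hT : IsTnorm T) (hTc : ContinuousOn2 T) (hA : TnormArchimedean T)
    {u : ℝ} (hu : u ∈ Icc (0:ℝ) 1) (hu0 : 0 < u) {n k : ℕ} (hn : 0 < n) (hk : 0 < k) :
    Tpow T (Troot T u (n * k)) k = Troot T u n := by
  have hw := root_mem T u (n * k)
  have h : Tpow T (Tpow T (Troot T u (n * k)) k) n = u := by
    rw [← hT.pow_mul hw, mul_comm k n, hT.root_pow hTc hA hu hu0 (Nat.mul_pos hn hk)]
  conv_rhs => rw [← h]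
  exact (hT.root_eq hTc hA (hT.pow_mem hw k) hn (h.symm ▸ hu0)).symm

theorem tendsto_root_one (hT : IsTnorm T) (hA : TnormArchimedean T)
    {u : ℝ} (hu0 : 0 < u) : Tendsto (Troot T u) atTop (𝓝 1) := by
  refine tendsto_order.2 ⟨fun a ha => ?_, fun a ha => ?_⟩
  · obtain ⟨b, hab, hb1⟩ := exists_between (max_lt ha zero_lt_one)
    have hb : b ∈ Icc (0:ℝ) 1 := ⟨((le_max_right _ _).trans_lt hab).le, hb1.le⟩
    filter_upwards [(hT.tendsto_pow_zero hA hb hb1).eventually_lt_const hu0] with n hn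
    exact ((le_max_left _ _).trans_lt hab).trans_le
      (le_csSup ⟨1, fun _ h => h.1.2⟩ ⟨hb, hn⟩)
  · exact Eventually.of_forall fun n => (root_mem T u n).2.trans_lt ha

theorem ratPow_mem (hT : IsTnorm T) (u : ℝ) (r : ℚ) : TratPow T u r ∈ Icc (0:ℝ) 1 :=
  hT.pow_mem (root_mem T u _) _

theorem ratPow_div (hT : IsTnorm T) (hTc : ContinuousOn2 T) (hA : TnormArchimedean T)
    {u : ℝ} (hu : u ∈ Icc (0:ℝ) 1) (hu0 : 0 < u) (m : ℕ) {n : ℕ} (hn : 0 < n) :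
    TratPow T u ((m : ℚ) / n) = Tpow T (Troot T u n) m := by
  obtain ⟨k, hk⟩ : ((m : ℚ) / n).den ∣ n := by
    have := Rat.den_dvd (m : ℤ) (n : ℤ)
    rw [Rat.divInt_eq_div, Int.cast_natCast, Int.cast_natCast] at this
    exact Int.natCast_dvd_natCast.1 this
  set r : ℚ := (m : ℚ) / n with hr
  have hk0 : 0 < k := Nat.pos_of_ne_zero (by rintro rfl; simp at hk; omega)
  have hr0 : 0 ≤ r := by positivity
  have hm : m = k * r.num.toNat := by
    have hnum : ((r.num.toNat : ℤ) : ℚ) = r.num := by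
      rw [Int.toNat_of_nonneg (Rat.num_nonneg.2 hr0)]
    have h1 : r * r.den = r.num := Rat.mul_den_eq_num r
    have h2 : r * n = m := by
      rw [hr]; field_simp
    have h3 : (m : ℚ) = k * r.num.toNat := by
      have : (n : ℚ) = r.den * k := by exact_mod_cast hk
      rw [← h2, this, ← mul_assoc, h1, ← hnum]
      push_cast
      ring
    exact_mod_cast h3
  have hroot := hT.root_mul_pow hTc hA hu hu0 r.den_pos hk0
  rw [← hk] at hroot
  rw [TratPow, ← hroot, ← hT.pow_mul (root_mem T u n), ← hm]

theorem _root_.Rat.exists_nat_div_nat_eq {r : ℚ} (hr : 0 ≤ r) {n : ℕ} (hn : 0 < n) :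
    ∃ a : ℕ, r = (a : ℚ) / ((r.den * n : ℕ) : ℚ) := by
  refine ⟨r.num.toNat * n, ?_⟩
  have hnum : ((r.num.toNat : ℤ) : ℚ) = r.num := by
    rw [Int.toNat_of_nonneg (Rat.num_nonneg.2 hr)]
  have hn' : (n : ℚ) ≠ 0 := by positivity
  have hd : (r.den : ℚ) ≠ 0 := by exact_mod_cast r.den_nz
  push_cast at hnum ⊢
  rw [hnum, mul_div_mul_right _ _ hn', Rat.num_div_den]

theorem ratPow_add (hT : IsTnorm T) (hTc : ContinuousOn2 T) (hA : TnormArchimedean T)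
    {u : ℝ} (hu : u ∈ Icc (0:ℝ) 1) (hu0 : 0 < u) {r s : ℚ} (hr : 0 ≤ r) (hs : 0 ≤ s) :
    TratPow T u (r + s) = T (TratPow T u r) (TratPow T u s) := by
  obtain ⟨a, ha⟩ := Rat.exists_nat_div_nat_eq hr s.den_pos
  obtain ⟨b, hb⟩ := Rat.exists_nat_div_nat_eq hs r.den_pos
  rw [mul_comm s.den] at hb
  have hN : 0 < r.den * s.den := Nat.mul_pos r.den_pos s.den_pos
  generalize r.den * s.den = N at ha hb hN
  subst ha hb
  rw [← add_div, ← Nat.cast_add, hT.ratPow_div hTc hA hu hu0 _ hN,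
    hT.ratPow_div hTc hA hu hu0 _ hN, hT.ratPow_div hTc hA hu hu0 _ hN,
    hT.pow_add (root_mem T u N)]

theorem ratPow_anti (hT : IsTnorm T) (hTc : ContinuousOn2 T) (hA : TnormArchimedean T)
    {u : ℝ} (hu : u ∈ Icc (0:ℝ) 1) (hu0 : 0 < u) {r s : ℚ} (hr : 0 ≤ r) (hrs : r ≤ s) :
    TratPow T u s ≤ TratPow T u r := by
  rw [← add_sub_cancel r s, hT.ratPow_add hTc hA hu hu0 hr (sub_nonneg.2 hrs)]
  exact hT.le_left (hT.ratPow_mem u r) (hT.ratPow_mem u _)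

theorem bddBelow_ratPow (hT : IsTnorm T) (u : ℝ) (s : Set ℚ) : BddBelow (TratPow T u '' s) :=
  ⟨0, by rintro _ ⟨r, -, rfl⟩; exact (hT.ratPow_mem u r).1⟩

theorem rePow_le_ratPow (hT : IsTnorm T) (u : ℝ) {t : ℝ} {r : ℚ} (hr : 0 ≤ r)
    (hrt : (r : ℝ) ≤ t) : TrePow T u t ≤ TratPow T u r :=
  csInf_le (hT.bddBelow_ratPow u _) ⟨r, ⟨hr, hrt⟩, rfl⟩

theorem le_rePow {u t a : ℝ} (ht : 0 ≤ t)
    (h : ∀ r : ℚ, 0 ≤ r → (r : ℝ) ≤ t → a ≤ TratPow T u r) : a ≤ TrePow T u t := by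
  refine le_csInf ⟨_, 0, ⟨le_rfl, by simpa using ht⟩, rfl⟩ ?_
  rintro _ ⟨r, hr, rfl⟩
  exact h r hr.1 hr.2

theorem rePow_anti (hT : IsTnorm T) (u : ℝ) {s t : ℝ} (hs : 0 ≤ s) (hst : s ≤ t) :
    TrePow T u t ≤ TrePow T u s :=
  le_rePow hs fun _ hr hrs => hT.rePow_le_ratPow u hr (hrs.trans hst)

theorem rePow_nonneg (hT : IsTnorm T) (u : ℝ) {t : ℝ} (ht : 0 ≤ t) : 0 ≤ TrePow T u t :=
  le_rePow ht fun r _ _ => (hT.ratPow_mem u r).1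

theorem exists_sub_le_mul (hT : IsTnorm T) (hTc : ContinuousOn2 T) {ε : ℝ} (hε : 0 < ε) :
    ∃ a < (1:ℝ), ∀ x ∈ Icc (0:ℝ) 1, ∀ w ∈ Icc (0:ℝ) 1, a < w → x - ε ≤ T x w := by
  have huc := (isCompact_Icc.prod isCompact_Icc).uniformContinuousOn_of_continuous hTc
  obtain ⟨δ, hδ, h⟩ := Metric.uniformContinuousOn_iff.1 huc ε hε
  refine ⟨1 - δ, by linarith, fun x hx w hw haw => ?_⟩
  have hd : dist (x, w) (x, 1) < δ := by
    rw [Prod.dist_eq, dist_self, max_eq_right dist_nonneg, Real.dist_eq, abs_lt]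
    constructor <;> linarith [hw.2]
  have := h (x, w) ⟨hx, hw⟩ (x, 1) ⟨hx, by simp⟩ hd
  rw [Real.dist_eq, hT.one x hx, abs_lt] at this
  linarith [this.1]

/-- Positive bases: real powers are uniformly close for close exponents. -/
theorem exists_rePow_sub_le (hT : IsTnorm T) (hTc : ContinuousOn2 T) (hA : TnormArchimedean T)
    {u : ℝ} (hu : u ∈ Icc (0:ℝ) 1) (hu0 : 0 < u) {ε : ℝ} (hε : 0 < ε) :
    ∃ δ > 0, ∀ s t : ℝ, 0 ≤ s → s ≤ t → t ≤ s + δ → TrePow T u s - ε ≤ TrePow T u t := by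
  obtain ⟨a, ha1, ha⟩ := hT.exists_sub_le_mul hTc hε
  obtain ⟨n, hn, hn0⟩ := (((hT.tendsto_root_one hA hu0).eventually_const_lt ha1).and
    (eventually_gt_atTop 0)).exists
  have hroot : TratPow T u ((1 : ℚ) / n) = Troot T u n := by
    simpa only [Nat.cast_one, hT.pow_one (root_mem T u n)] using
      hT.ratPow_div hTc hA hu hu0 1 hn0
  have hn' : (0 : ℚ) < 1 / n := by positivity
  refine ⟨1 / n, by positivity, fun s t hs hst hts => ?_⟩
  refine le_rePow (hs.trans hst) fun r hr hrt => ?_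
  set q : ℚ := max (r - 1 / n) 0 with hq
  have hq0 : 0 ≤ q := le_max_right _ _
  have hqs : (q : ℝ) ≤ s := by
    rw [hq]
    push_cast
    exact max_le (by linarith) hs
  have hrq : r ≤ q + 1 / n := by linarith [le_max_left (r - 1 / (n : ℚ)) 0]
  calc TrePow T u s - ε ≤ TratPow T u q - ε := by
        linarith [hT.rePow_le_ratPow u hq0 hqs]
    _ ≤ T (TratPow T u q) (Troot T u n) := ha _ (hT.ratPow_mem u q) _ (root_mem T u n) hn
    _ = TratPow T u (q + 1 / n) := by rw [hT.ratPow_add hTc hA hu hu0 hq0 hn'.le, hroot]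
    _ ≤ TratPow T u r := hT.ratPow_anti hTc hA hu hu0 hr hrq

theorem continuousOn_rePow (hT : IsTnorm T) (hTc : ContinuousOn2 T) (hA : TnormArchimedean T)
    {u : ℝ} (hu : u ∈ Icc (0:ℝ) 1) (hu0 : 0 < u) : ContinuousOn (TrePow T u) (Ici (0:ℝ)) := by
  rw [Metric.continuousOn_iff]
  intro t ht ε hε
  obtain ⟨δ, hδ, h⟩ := hT.exists_rePow_sub_le hTc hA hu hu0 (half_pos hε)
  refine ⟨δ, hδ, fun s hs hst => ?_⟩
  rw [mem_Ici] at hs ht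
  rw [Real.dist_eq, abs_lt] at hst ⊢
  rcases le_total s t with hle | hle
  · have h1 := h s t hs hle (by linarith)
    have h2 := hT.rePow_anti u hs hle
    constructor <;> linarith
  · have h1 := h t s ht hle (by linarith)
    have h2 := hT.rePow_anti u ht hle
    constructor <;> linarith

theorem rePow_zero_left (hT : IsTnorm T) {t : ℝ} (ht : 0 < t) : TrePow T 0 t = 0 := by
  refine le_antisymm ?_ (hT.rePow_nonneg 0 ht.le)
  obtain ⟨r, hr0, hrt⟩ := exists_rat_btwn ht
  have hr : 0 < r := by exact_mod_cast hr0
  refine (hT.rePow_le_ratPow 0 hr.le hrt.le).trans_eq ?_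
  have hroot : Troot T 0 r.den = 0 := by
    have : {v ∈ Icc (0:ℝ) 1 | Tpow T v r.den < 0} = ∅ :=
      eq_empty_of_forall_notMem fun v hv => hv.2.not_ge (hT.pow_mem hv.1 _).1
    rw [Troot, this, Real.sSup_empty]
  have hnum : 0 < r.num := Rat.num_pos.2 hr
  rw [TratPow, hroot, hT.zero_pow (by omega)]

theorem rePow_one_left (hT : IsTnorm T) (hTc : ContinuousOn2 T) (hA : TnormArchimedean T)
    {t : ℝ} (ht : 0 ≤ t) : TrePow T 1 t = 1 := by
  have hrat : ∀ r : ℚ, TratPow T 1 r = 1 := by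
    intro r
    have hroot := hT.root_eq hTc hA (v := 1) (by simp) r.den_pos (by simp [hT.one_pow])
    rw [hT.one_pow] at hroot
    rw [TratPow, hroot, hT.one_pow]
  refine le_antisymm ?_ (le_rePow ht fun r _ _ => (hrat r).ge)
  exact (hT.rePow_le_ratPow 1 le_rfl (by simpa using ht)).trans_eq (hrat 0)

theorem tendsto_rePow_zero (hT : IsTnorm T) (hTc : ContinuousOn2 T) (hA : TnormArchimedean T)
    {u : ℝ} (hu : u ∈ Icc (0:ℝ) 1) (hu0 : 0 < u) (hu1 : u < 1) :
    Tendsto (TrePow T u) atTop (𝓝 0) := by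
  have hnat : ∀ n : ℕ, TratPow T u n = Tpow T u n := by
    intro n
    have hroot := hT.root_eq hTc hA hu one_pos (by rwa [hT.pow_one hu])
    rw [hT.pow_one hu] at hroot
    simpa only [Nat.cast_one, div_one, hroot] using hT.ratPow_div hTc hA hu hu0 n one_pos
  refine squeeze_zero' ?_ ?_
    ((hT.tendsto_pow_zero hA hu hu1).comp (tendsto_nat_floor_atTop (α := ℝ)))
  · filter_upwards [eventually_ge_atTop 0] with t ht using hT.rePow_nonneg u ht
  · filter_upwards [eventually_ge_atTop 0] with t ht
    rw [Function.comp_apply, ← hnat]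
    exact hT.rePow_le_ratPow u (Nat.cast_nonneg _) (by simpa using Nat.floor_le ht)

end IsTnorm

/-- For a continuous Archimedean t-norm, `t ↦ u_T^(t)` is continuous on
`(0,∞)`, tends to `0` at `+∞` when `u ∈ [0,1)` and to `1` when `u = 1`. -/
theorem pow_continuous_and_limit (T : ℝ → ℝ → ℝ) (hT : IsTnorm T) (hTc : ContinuousOn2 T)
    (hA : TnormArchimedean T) (u : ℝ) (hu : u ∈ Icc (0:ℝ) 1) :
    ContinuousOn (fun t => TrePow T u t) (Ioi (0:ℝ)) ∧
    (u < 1 → Filter.Tendsto (fun t => TrePow T u t) Filter.atTop (nhds 0)) ∧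
    (u = 1 → Filter.Tendsto (fun t => TrePow T u t) Filter.atTop (nhds 1)) := by
  have hcongr : ∀ c : ℝ, (∀ t > 0, TrePow T u t = c) →
      Filter.Tendsto (fun t => TrePow T u t) Filter.atTop (nhds c) := fun c h =>
    tendsto_const_nhds.congr' <| by
      filter_upwards [eventually_gt_atTop (0:ℝ)] with t ht using (h t ht).symm
  rcases hu.1.eq_or_lt with rfl | hu0
  · exact ⟨continuousOn_const.congr fun t ht => hT.rePow_zero_left ht,
      fun _ => hcongr 0 fun t ht => hT.rePow_zero_left ht, fun h => absurd h zero_ne_one⟩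
  · refine ⟨(hT.continuousOn_rePow hTc hA hu hu0).mono Ioi_subset_Ici_self,
      fun hu1 => hT.tendsto_rePow_zero hTc hA hu hu0 hu1, ?_⟩
    rintro rfl
    exact hcongr 1 fun t ht => hT.rePow_one_left hTc hA ht.le
end

section
/- Let T be a continuous Archimedean t-norm on [0,1] with a continuous additive generator G. Then for every u ∈ (0,1] and every real t > 0, u_T^(t) = G^(−1)(t·G(u)) = G^{-1}(min(t·G(u), G(0))). Moreover, if T is strict, then u_T^(t) = G^{-1}(t·G(u)). -/
open Set

namespace IsAddGen

variable {T : ℝ → ℝ → ℝ} {G : ℝ → ENNReal}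

theorem exists_eq (hG : IsAddGen T G) (hGc : ContinuousOn G (Icc (0:ℝ) 1)) {y : ENNReal}
    (hy : y ≤ G 0) : ∃ x ∈ Icc (0:ℝ) 1, G x = y := by
  have h := intermediate_value_Icc' (zero_le_one' ℝ) hGc
  exact h ⟨by simp [hG.map_one], hy⟩

theorem le_map_zero (hG : IsAddGen T G) {x : ℝ} (hx : x ∈ Icc (0:ℝ) 1) : G x ≤ G 0 :=
  hG.strictAnti.antitoneOn ⟨le_rfl, zero_le_one⟩ hx hx.1

theorem pseudoInv_eq (hG : IsAddGen T G) {x : ℝ} (hx : x ∈ Icc (0:ℝ) 1) {y : ENNReal}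
    (h : G x = min y (G 0)) : pseudoInv G y = x := by
  have hset : {z ∈ Icc (0:ℝ) 1 | y < G z} = Ico 0 x := by
    ext z
    simp only [mem_ofPred_eq, mem_Ico]
    constructor
    · rintro ⟨hz, hyz⟩
      refine ⟨hz.1, (hG.strictAnti.lt_iff_gt hx hz).1 ?_⟩
      rw [h]
      exact (min_le_left _ _).trans_lt hyz
    · rintro ⟨hz, hzx⟩
      have hz' : z ∈ Icc (0:ℝ) 1 := ⟨hz, hzx.le.trans hx.2⟩
      refine ⟨hz', ?_⟩
      have hlt := hG.strictAnti hz' hx hzx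
      rw [h, min_lt_iff] at hlt
      exact hlt.resolve_right (hG.le_map_zero hz').not_gt
  rw [pseudoInv, hset]
  rcases hx.1.eq_or_lt with h0 | h0
  · simp [← h0]
  · exact csSup_Ico h0

theorem pseudoInv_spec (hG : IsAddGen T G) (hGc : ContinuousOn G (Icc (0:ℝ) 1)) (y : ENNReal) :
    pseudoInv G y ∈ Icc (0:ℝ) 1 ∧ G (pseudoInv G y) = min y (G 0) := by
  obtain ⟨x, hx, h⟩ := hG.exists_eq hGc (min_le_right y (G 0))
  rw [hG.pseudoInv_eq hx h]
  exact ⟨hx, h⟩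

theorem invFunOn_min (hG : IsAddGen T G) (hGc : ContinuousOn G (Icc (0:ℝ) 1)) (y : ENNReal) :
    Function.invFunOn G (Icc (0:ℝ) 1) (min y (G 0)) = pseudoInv G y := by
  obtain ⟨hm, h⟩ := hG.pseudoInv_spec hGc y
  have hex : ∃ a ∈ Icc (0:ℝ) 1, G a = min y (G 0) := ⟨_, hm, h⟩
  exact hG.strictAnti.injOn (Function.invFunOn_mem hex) hm
    ((Function.invFunOn_eq hex).trans h.symm)

theorem map_op (hG : IsAddGen T G) (hGc : ContinuousOn G (Icc (0:ℝ) 1)) {x y : ℝ}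
    (hx : x ∈ Icc (0:ℝ) 1) (hy : y ∈ Icc (0:ℝ) 1) : G (T x y) = min (G x + G y) (G 0) := by
  rw [hG.eq_pseudoInv x hx y hy]
  exact (hG.pseudoInv_spec hGc _).2

theorem Tpow_mem (hT : IsTnorm T) {u : ℝ} (hu : u ∈ Icc (0:ℝ) 1) (n : ℕ) :
    Tpow T u n ∈ Icc (0:ℝ) 1 := by
  induction n with
  | zero => exact ⟨zero_le_one, le_rfl⟩
  | succ n ih => exact hT.maps_to _ ih _ hu

theorem map_Tpow (hT : IsTnorm T) (hG : IsAddGen T G) (hGc : ContinuousOn G (Icc (0:ℝ) 1))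
    {u : ℝ} (hu : u ∈ Icc (0:ℝ) 1) (n : ℕ) : G (Tpow T u n) = min (n * G u) (G 0) := by
  induction n with
  | zero => simp [Tpow, hG.map_one]
  | succ n ih =>
    rw [Tpow, hG.map_op hGc (Tpow_mem hT hu n) hu, ih, Nat.cast_succ, add_mul, one_mul]
    rcases le_total (n * G u) (G 0) with h | h
    · rw [min_eq_left h]
    · rw [min_eq_right h, min_eq_right le_self_add, min_eq_right (h.trans le_self_add)]

theorem Troot_eq (hT : IsTnorm T) (hG : IsAddGen T G) (hGc : ContinuousOn G (Icc (0:ℝ) 1))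
    {u : ℝ} (hu : u ∈ Ioc (0:ℝ) 1) {p : ℕ} (hp : p ≠ 0) :
    Troot T u p = pseudoInv G (G u / p) := by
  have hu' : u ∈ Icc (0:ℝ) 1 := Ioc_subset_Icc_self hu
  have hu0 : G u < G 0 := hG.strictAnti ⟨le_rfl, zero_le_one⟩ hu' hu.1
  rw [Troot, pseudoInv]
  congr 1
  ext v
  simp only [mem_ofPred_eq]
  refine and_congr_right fun hv => ?_
  rw [← hG.strictAnti.lt_iff_gt hu' (Tpow_mem hT hv p), map_Tpow hT hG hGc hv, lt_min_iff,
    and_iff_left hu0, mul_comm, ENNReal.div_lt_iff (by simp [hp]) (by simp)]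

theorem TratPow_eq (hT : IsTnorm T) (hG : IsAddGen T G) (hGc : ContinuousOn G (Icc (0:ℝ) 1))
    {u : ℝ} (hu : u ∈ Ioc (0:ℝ) 1) {r : ℚ} (hr : 0 ≤ r) :
    TratPow T u r = pseudoInv G (ENNReal.ofReal r * G u) := by
  obtain ⟨hm, h⟩ := hG.pseudoInv_spec hGc (G u / r.den)
  have hle : G u / r.den ≤ G 0 := by
    refine le_trans ?_ (hG.le_map_zero (Ioc_subset_Icc_self hu))
    exact ENNReal.div_le_of_le_mul (le_mul_of_one_le_right' (by exact_mod_cast r.den_pos))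
  rw [min_eq_left hle] at h
  rw [TratPow, Troot_eq hT hG hGc hu r.den_nz]
  refine (hG.pseudoInv_eq (Tpow_mem hT hm _) ?_).symm
  rw [map_Tpow hT hG hGc hm, h]
  congr 1
  have hcast : (r : ℝ) = (r.num.toNat : ℝ) / (r.den : ℝ) := by
    have h1 : ((r.num.toNat : ℤ) : ℝ) = (r.num : ℝ) := by
      rw [Int.toNat_of_nonneg (Rat.num_nonneg.2 hr)]
    rw [Rat.cast_def, ← h1, Int.cast_natCast]
  rw [hcast, ENNReal.ofReal_div_of_pos (by exact_mod_cast r.den_pos), ENNReal.ofReal_natCast,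
    ENNReal.ofReal_natCast, div_eq_mul_inv, div_eq_mul_inv, mul_assoc, mul_comm (G u)]

theorem TrePow_eq (hT : IsTnorm T) (hG : IsAddGen T G) (hGc : ContinuousOn G (Icc (0:ℝ) 1))
    {u : ℝ} (hu : u ∈ Ioc (0:ℝ) 1) {t : ℝ} (ht : 0 < t) :
    TrePow T u t = pseudoInv G (ENNReal.ofReal t * G u) := by
  have hu' : u ∈ Icc (0:ℝ) 1 := Ioc_subset_Icc_self hu
  have hu0 : G u < G 0 := hG.strictAnti ⟨le_rfl, zero_le_one⟩ hu' hu.1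
  obtain ⟨hm, h⟩ := hG.pseudoInv_spec hGc (ENNReal.ofReal t * G u)
  refine csInf_eq_of_forall_ge_of_forall_gt_exists_lt
    (Nonempty.image _ ⟨0, le_rfl, by simpa using ht.le⟩) ?_ ?_
  · rintro _ ⟨r, ⟨hr, hrt⟩, rfl⟩
    obtain ⟨hmr, hr'⟩ := hG.pseudoInv_spec hGc (ENNReal.ofReal r * G u)
    rw [TratPow_eq hT hG hGc hu hr, ← hG.strictAnti.le_iff_ge hmr hm, h, hr']
    gcongr
  · intro w hw
    by_cases hw1 : 1 < w
    · refine ⟨TratPow T u 0, ⟨0, ⟨le_rfl, by simpa using ht.le⟩, rfl⟩, lt_of_le_of_lt ?_ hw1⟩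
      rw [TratPow_eq hT hG hGc hu le_rfl]
      exact (hG.pseudoInv_spec hGc _).1.2
    have hwI : w ∈ Icc (0:ℝ) 1 := ⟨hm.1.trans hw.le, not_lt.1 hw1⟩
    have hlt := hG.strictAnti hm hwI hw
    rw [h, lt_min_iff] at hlt
    have hGu : G u ≠ 0 := by
      intro h0
      simp [h0] at hlt
    have hdiv : G w / G u < ENNReal.ofReal t :=
      (ENNReal.div_lt_iff (.inl hGu) (.inl hu0.ne_top)).2 hlt.1
    have hreal : (G w / G u).toReal < t := by
      rw [← ENNReal.toReal_ofReal ht.le]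
      exact ENNReal.toReal_strict_mono ENNReal.ofReal_ne_top hdiv
    obtain ⟨r, hr1, hr2⟩ := exists_rat_btwn hreal
    have hr0 : 0 ≤ r := by exact_mod_cast ENNReal.toReal_nonneg.trans hr1.le
    refine ⟨_, ⟨r, ⟨hr0, hr2.le⟩, rfl⟩, ?_⟩
    obtain ⟨hmr, hr'⟩ := hG.pseudoInv_spec hGc (ENNReal.ofReal r * G u)
    rw [TratPow_eq hT hG hGc hu hr0, ← hG.strictAnti.lt_iff_gt hwI hmr, hr', lt_min_iff]
    refine ⟨?_, hlt.2⟩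
    rw [← ENNReal.div_lt_iff (.inl hGu) (.inl hu0.ne_top)]
    exact (ENNReal.lt_ofReal_iff_toReal_lt hdiv.ne_top).2 hr1

theorem map_zero_eq_top (hG : IsAddGen T G) (hGc : ContinuousOn G (Icc (0:ℝ) 1))
    (hT : IsTnorm T) (hS : TnormStrictMono T) : G 0 = ⊤ := by
  by_contra htop
  have h0 : (0:ℝ) ∈ Icc (0:ℝ) 1 := ⟨le_rfl, zero_le_one⟩
  have hpos : G 0 ≠ 0 := by
    have := hG.strictAnti h0 ⟨zero_le_one, le_rfl⟩ zero_lt_one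
    exact (bot_le.trans_lt this).ne'
  obtain ⟨x, hx, hxe⟩ := hG.exists_eq hGc (ENNReal.half_le_self (a := G 0))
  have hx0 : 0 < x := by
    rw [← hG.strictAnti.lt_iff_gt hx h0, hxe]
    exact ENNReal.half_lt_self hpos htop
  have hlt := hS x hx hx0 0 h0 x hx hx0
  rw [← hG.strictAnti.lt_iff_gt (hT.maps_to x hx x hx) (hT.maps_to x hx 0 h0),
    hG.map_op hGc hx hx, hxe, ENNReal.add_halves, min_self] at hlt
  exact hlt.not_ge (hG.le_map_zero (hT.maps_to x hx 0 h0))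

end IsAddGen

/-- For a continuous Archimedean t-norm `T` with continuous additive
generator `G`, for `u ∈ (0,1]` and real `t > 0`:
`u_T^(t) = G^(−1)(t·G(u)) = G⁻¹(min (t·G(u)) (G 0))`; if moreover `T` is strict,
then `u_T^(t) = G⁻¹(t·G(u))`. -/
theorem realPow_via_generator (T : ℝ → ℝ → ℝ) (G : ℝ → ENNReal)
    (hT : IsTnorm T) (hTc : ContinuousOn2 T) (hA : TnormArchimedean T)
    (hG : IsAddGen T G) (hGc : ContinuousOn G (Icc (0:ℝ) 1)) :
    ∀ u ∈ Ioc (0:ℝ) 1, ∀ t : ℝ, 0 < t →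
      TrePow T u t = pseudoInv G (ENNReal.ofReal t * G u) ∧
      TrePow T u t =
        Function.invFunOn G (Icc (0:ℝ) 1) (min (ENNReal.ofReal t * G u) (G 0)) ∧
      (TnormStrictMono T →
        TrePow T u t = Function.invFunOn G (Icc (0:ℝ) 1) (ENNReal.ofReal t * G u)) := by
  intro u hu t ht
  have h := IsAddGen.TrePow_eq hT hG hGc hu ht
  refine ⟨h, h.trans (hG.invFunOn_min hGc _).symm, fun hS => ?_⟩
  rw [h, ← hG.invFunOn_min hGc, hG.map_zero_eq_top hGc hT hS, min_top_right]
end
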